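/- arXiv:1401.6203 — 3 statements merged into one kernel-verified Lean document; each statement's English description precedes it below -/
import Mathlib

section
/- Every free group is subgroup into conjugacy separable (SICS). That is, for every type X, if H₁ and H₂ are finitely generated subgroups of the free group F(X) such that H₂ is not conjugate into H₁, then there exists a surjective group homomorphism φ from F(X) onto a finite group such that φ(H₂) is not conjugate into φ(H₁). -/
/-- `A.conjBy c` is the conjugate subgroup `A^c = c⁻¹ * A * c`. -/
def Subgroup.conjBy {G : Type*} [Group G] (A : Subgroup G) (c : G) : Subgroup G :=
  A.map (MulAut.conj c⁻¹).toMonoidHom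

/-- A group `G` is subgroup into conjugacy separable (SICS) if for any two finitely
generated subgroups `H₁`, `H₂` of `G` such that `H₂` is not conjugate into `H₁`,
there is a finite quotient of `G` in which the image of `H₂` is not conjugate into
the image of `H₁`. -/
def SICS (G : Type*) [Group G] : Prop :=
  ∀ H₁ H₂ : Subgroup G, H₁.FG → H₂.FG → (¬ ∃ c : G, H₂.conjBy c ≤ H₁) →
    ∃ (Q : Type) (_ : Group Q) (_ : Finite Q) (φ : G →* Q),
      Function.Surjective φ ∧ ¬ ∃ q : Q, (H₂.map φ).conjBy q ≤ H₁.map φ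

namespace FreeGroup

open Equiv

theorem mk_cons {X : Type*} (l : X × Bool) (L : List (X × Bool)) :
    mk (l :: L) = mk [l] * mk L := by
  rw [mul_mk, List.singleton_append]

section SkewProduct

variable {X V Q : Type*} [Group Q]

/-- The skew product action of `FreeGroup X` on `V × Q` whose generators act on `V` by `π` and
translate the fibre over `v` by `σ x v`. -/
def skewProduct (π : X → Perm V) (σ : X → V → Q) : FreeGroup X →* Perm (V × Q) :=
  lift fun x =>
    { toFun := fun p => (π x p.1, σ x p.1 * p.2)
      invFun := fun p => ((π x).symm p.1, (σ x ((π x).symm p.1))⁻¹ * p.2)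
      left_inv := fun p => by simp
      right_inv := fun p => by simp }

variable (π : X → Perm V) (σ : X → V → Q)

theorem skewProduct_mk_true (x : X) (v : V) (q : Q) :
    skewProduct π σ (mk [(x, true)]) (v, q) = (π x v, σ x v * q) := by
  simp [skewProduct]

theorem skewProduct_mk_false (x : X) (v : V) (q : Q) :
    skewProduct π σ (mk [(x, false)]) (π x v, q) = (v, (σ x v)⁻¹ * q) := by
  have : (skewProduct π σ (mk [(x, false)])) = (skewProduct π σ (mk [(x, true)]))⁻¹ := by
    rw [← _root_.map_inv, inv_mk]; rfl
  rw [this, Perm.inv_eq_iff_eq, skewProduct_mk_true]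
  simp

/-- Skew products are functorial in the fibre and commute with right translations of it. -/
theorem skewProduct_map {R : Type*} [Group R] (f : Q →* R) (g : FreeGroup X) (v : V) (q : Q)
    (r : R) :
    skewProduct π (fun x v => f (σ x v)) g (v, f q * r) =
      ((skewProduct π σ g (v, q)).1, f (skewProduct π σ g (v, q)).2 * r) := by
  obtain ⟨L, rfl⟩ := Quot.exists_rep g
  rw [quot_mk_eq_mk]
  induction L with
  | nil => simp [← one_eq_mk]
  | cons l L ih =>
    rw [mk_cons, _root_.map_mul, _root_.map_mul, Perm.mul_apply, Perm.mul_apply, ih]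
    generalize skewProduct π σ (mk L) (v, q) = p
    obtain ⟨u, z⟩ := p
    obtain ⟨x, _ | _⟩ := l
    · obtain ⟨u, rfl⟩ := (π x).surjective u
      simp [skewProduct_mk_false, mul_assoc]
    · simp [skewProduct_mk_true, mul_assoc]

end SkewProduct

section Truncation

variable {X S : Type*} [MulAction (FreeGroup X) S] {B : Set S}

/-- The permutations `π` of `B` extend the partial action of the generators on `B`. -/
def ExtendsPartialAction (B : Set S) (π : X → Perm B) : Prop :=
  ∀ (x : X) (v : B) (h : of x • (v : S) ∈ B), π x v = ⟨of x • (v : S), h⟩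

theorem exists_extendsPartialAction [Finite B] : ∃ π : X → Perm B, ExtendsPartialAction B π := by
  have key (x : X) : ∃ τ : Perm B, ∀ a : {v : B // of x • (v : S) ∈ B},
      τ a = ⟨of x • ((a : B) : S), a.2⟩ :=
    Perm.exists_extending_pair _ _ Subtype.val_injective fun a b h => by
      simpa [Subtype.ext_iff] using h
  choose π hπ using key
  exact ⟨π, fun x v h => hπ x ⟨v, h⟩⟩

variable {Q : Type*} [Group Q] {π : X → Perm B} {σ : X → B → Q}

theorem ExtendsPartialAction.skewProduct_letter (hπ : ExtendsPartialAction B π)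
    (hσ : ∀ x (v : B), of x • (v : S) ∈ B → σ x v = 1) (l : X × Bool) (v : B) (q : Q)
    (h : mk [l] • (v : S) ∈ B) : skewProduct π σ (mk [l]) (v, q) = (⟨mk [l] • (v : S), h⟩, q) := by
  obtain ⟨x, _ | _⟩ := l
  · set u : B := ⟨_, h⟩ with hu
    have hxu : of x • (u : S) = v := by
      have : mk [(x, false)] = (of x)⁻¹ := rfl
      simp [hu, this]
    have hmem : of x • (u : S) ∈ B := hxu ▸ v.2
    have hv : v = π x u := by rw [hπ x u hmem]; exact Subtype.ext hxu.symm
    conv_lhs => rw [hv]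
    rw [skewProduct_mk_false, hσ x u hmem, inv_one, one_mul]
  · rw [skewProduct_mk_true, hπ x v h, hσ x v h, one_mul]
    rfl

/-- As long as a path stays inside `B`, the skew product follows the original action. -/
theorem ExtendsPartialAction.skewProduct_path (hπ : ExtendsPartialAction B π)
    (hσ : ∀ x (v : B), of x • (v : S) ∈ B → σ x v = 1) (L : List (X × Bool)) (v : B) (q : Q)
    (hL : ∀ L', L' <:+ L → mk L' • (v : S) ∈ B) :
    skewProduct π σ (mk L) (v, q) = (⟨mk L • (v : S), hL L L.suffix_refl⟩, q) := by
  induction L with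
  | nil => simp [← one_eq_mk]
  | cons l L ih =>
    have h := hL _ (List.suffix_refl _)
    simp only [mk_cons l L, mul_smul] at h ⊢
    rw [_root_.map_mul, Perm.mul_apply, ih fun L' hL' => hL L' (hL'.trans (List.suffix_cons l L)),
      hπ.skewProduct_letter hσ l _ q h]

open Classical in
/-- The cocycle which is trivial on the edges of the partial action on `B` and free on all other
edges. -/
noncomputable def freeCocycle (B : Set S) (x : X) (v : B) : FreeGroup (X × B) :=
  if of x • (v : S) ∈ B then 1 else of (x, v)

theorem freeCocycle_eq_one (x : X) (v : B) (h : of x • (v : S) ∈ B) : freeCocycle B x v = 1 :=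
  if_pos h

theorem ExtendsPartialAction.skewProduct_letter_cases (hπ : ExtendsPartialAction B π)
    (x : X) (b : Bool) (v : B) (z : FreeGroup (X × B)) :
    (∃ h : mk [(x, b)] • (v : S) ∈ B,
      skewProduct π (freeCocycle B) (mk [(x, b)]) (v, z) = (⟨mk [(x, b)] • (v : S), h⟩, z)) ∨
    ∃ s : B, of x • (s : S) ∉ B ∧ v = (if b then s else π x s) ∧
      skewProduct π (freeCocycle B) (mk [(x, b)]) (v, z) =
        (if b then π x s else s, mk [((x, s), b)] * z) := by
  by_cases h : mk [(x, b)] • (v : S) ∈ B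
  · exact .inl ⟨h, hπ.skewProduct_letter freeCocycle_eq_one (x, b) v z h⟩
  right
  obtain _ | _ := b
  · obtain ⟨s, rfl⟩ := (π x).surjective v
    have hs : of x • (s : S) ∉ B := fun hs => h <| by
      have : mk [(x, false)] = (of x)⁻¹ := rfl
      simp [hπ x s hs, this]
    refine ⟨s, hs, rfl, ?_⟩
    rw [skewProduct_mk_false, freeCocycle, if_neg hs]
    rfl
  · refine ⟨v, h, rfl, ?_⟩
    rw [skewProduct_mk_true, freeCocycle, if_neg (show of x • (v : S) ∉ B from h)]
    rfl

open Classical in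
/-- If every point of `B` fixed by a nonempty subword of the reduced word `L` has its neighbours
in `B`, then the free cocycle along `L` is a reduced word: either `L` never leaves the partial
action on `B`, or the last edge outside of it contributes the first letter. -/
theorem ExtendsPartialAction.skewProduct_reduced (hπ : ExtendsPartialAction B π)
    {L : List (X × Bool)} (hred : IsReduced L)
    (hB : ∀ γ, γ <:+: L → γ ≠ [] → ∀ t ∈ B, mk γ • t = t →
      ∀ l ∈ L, of l.1 • t ∈ B ∧ (of l.1)⁻¹ • t ∈ B) (v : B) :
    (((skewProduct π (freeCocycle B) (mk L) (v, 1)).1 : S) = mk L • (v : S) ∧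
      (skewProduct π (freeCocycle B) (mk L) (v, 1)).2 = 1) ∨
    ∃ γ x b L', ∃ s : B, ∃ ζ, L = γ ++ (x, b) :: L' ∧ of x • (s : S) ∉ B ∧
      ((skewProduct π (freeCocycle B) (mk L) (v, 1)).1 : S) =
        mk γ • ((if b then π x s else s : B) : S) ∧
      (skewProduct π (freeCocycle B) (mk L) (v, 1)).2.toWord = ((x, s), b) :: ζ := by
  induction L with
  | nil => left; simp [← one_eq_mk]
  | cons l L ih =>
    have hsuff : L <:+: l :: L := (List.suffix_cons l L).isInfix
    specialize ih (hred.infix hsuff) fun γ hγ hne t ht hfix l' hl' =>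
      hB γ (hγ.trans hsuff) hne t ht hfix l' (List.mem_cons_of_mem _ hl')
    rw [mk_cons, _root_.map_mul, Perm.mul_apply]
    generalize skewProduct π (freeCocycle B) (mk L) (v, 1) = p at ih ⊢
    obtain ⟨u, z⟩ := p
    obtain ⟨x₀, b₀⟩ := l
    rcases hπ.skewProduct_letter_cases x₀ b₀ u z with ⟨h, he⟩ | ⟨s₀, hs₀, hu, he⟩
    · rw [he]
      rcases ih with ⟨h1, h2⟩ | ⟨γ, x, b, L', s, ζ, rfl, hs, h1, h2⟩
      · left
        exact ⟨by simp only at h1 ⊢; rw [h1, mul_smul], h2⟩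
      · right
        refine ⟨(x₀, b₀) :: γ, x, b, L', s, ζ, rfl, hs, ?_, h2⟩
        simp only at h1 ⊢
        rw [h1, mk_cons _ γ, mul_smul]
    · rw [he]
      right
      rcases ih with ⟨h1, h2⟩ | ⟨γ, x, b, L', s, ζ, rfl, hs, h1, h2⟩
      · simp only at h2
        refine ⟨[], x₀, b₀, L, s₀, [], rfl, hs₀, by simp [← one_eq_mk], ?_⟩
        simp [h2, toWord_mk]
      · refine ⟨[], x₀, b₀, _, s₀, ((x, s), b) :: ζ, rfl, hs₀, by simp [← one_eq_mk], ?_⟩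
        simp only at h1 h2
        rw [toWord_mul, toWord_mk, reduce_singleton, h2]
        have hz : IsReduced (((x, s), b) :: ζ) := h2 ▸ isReduced_toWord
        refine IsReduced.reduce_eq (isReduced_cons_cons.2 ⟨fun hxs => ?_, hz⟩)
        by_contra hb
        obtain ⟨rfl, rfl⟩ : x₀ = x ∧ s₀ = s := by simpa using hxs
        have hγ : γ ≠ [] := by
          rintro rfl
          exact hb ((isReduced_cons_cons.1 hred).1 rfl)
        have hinf : γ <:+: (x₀, b₀) :: (γ ++ (x₀, b) :: L') := ⟨[(x₀, b₀)], (x₀, b) :: L', by simp⟩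
        have hub : u = if b then π x₀ s₀ else s₀ := by
          rw [hu]; cases b₀ <;> cases b <;> simp_all
        have hfix : mk γ • (u : S) = u := by
          rw [← hub] at h1; exact h1.symm
        have hn := hB γ hinf hγ u u.2 hfix (x₀, b₀) List.mem_cons_self
        cases b₀ with
        | true =>
          simp only [if_true] at hu
          exact hs₀ (hu ▸ hn.1)
        | false =>
          have hu' : u = π x₀ s₀ := by simpa using hu
          have hback : of x₀ • (of x₀)⁻¹ • (u : S) = u := smul_inv_smul _ _
          have := hπ x₀ ⟨_, hn.2⟩ (by simp)
          simp only [hback] at this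
          have hs' : s₀ = ⟨_, hn.2⟩ := (π x₀).injective (by rw [this, ← hu'])
          apply hs₀
          rw [hs', hback]
          exact u.2

theorem finite_setOf_path (L : List (X × Bool)) (s : S) :
    {t : S | ∃ L', L' <:+ L ∧ mk L' • s = t}.Finite := by
  have : {L' | L' <:+ L}.Finite := L.tails.finite_toSet.subset fun L' h => (List.mem_tails _ _).2 h
  exact this.image fun L' => mk L' • s

end Truncation

/-- Free groups are residually finite. -/
instance residuallyFinite (X : Type*) : Group.ResiduallyFinite (FreeGroup X) := by
  classical
  refine Group.residuallyFinite_of_forall_exists_finite_monoidHom fun g hg => ?_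
  let B : Set (FreeGroup X) := {t | ∃ L', L' <:+ g.toWord ∧ mk L' • (1 : FreeGroup X) = t}
  have : Finite B := finite_setOf_path _ _
  obtain ⟨π, hπ⟩ := exists_extendsPartialAction (X := X) (B := B)
  refine ⟨Perm (B × Unit), inferInstance, inferInstance, skewProduct π fun _ _ => 1, fun h => hg ?_⟩
  have h1 : (1 : FreeGroup X) ∈ B := ⟨[], List.nil_suffix, by simp [← one_eq_mk]⟩
  have := hπ.skewProduct_path (Q := Unit) (σ := fun _ _ => 1) (fun _ _ _ => rfl) g.toWord ⟨1, h1⟩ 1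
    fun L' hL' => ⟨L', hL', rfl⟩
  simpa [h, mk_toWord] using this.symm

section FixedPoints

theorem suffix_append_cases {α : Type*} {L' L₁ L₂ : List α} (h : L' <:+ L₁ ++ L₂) :
    (∃ K, L' = K ++ L₂ ∧ K <:+ L₁) ∨ L' <:+ L₂ := by
  obtain ⟨P, hP⟩ := h
  rcases List.append_eq_append_iff.1 hP with ⟨K, rfl, rfl⟩ | ⟨K, rfl, rfl⟩
  · exact .inl ⟨K, rfl, List.suffix_append _ _⟩
  · exact .inr (List.suffix_append _ _)

variable {X S : Type*} [MulAction (FreeGroup X) S]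

/-- Free reduction of a word only removes vertices from the path it labels. -/
theorem Red.path_subset {L M : List (X × Bool)} (h : Red L M) {C : Set S} {s : S}
    (hL : ∀ L', L' <:+ L → mk L' • s ∈ C) (L' : List (X × Bool)) (hL' : L' <:+ M) :
    mk L' • s ∈ C := by
  induction h generalizing L' with
  | refl => exact hL L' hL'
  | tail _ hstep ih =>
    obtain @⟨L₁, L₂, x, b⟩ := hstep
    rcases suffix_append_cases hL' with ⟨K, rfl, hK⟩ | hK
    · have : mk (K ++ L₂) = mk (K ++ (x, b) :: (x, !b) :: L₂) := (Quot.sound Red.Step.not).symm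
      rw [this]
      obtain ⟨P, rfl⟩ := hK
      exact ih _ ⟨P, by simp⟩
    · exact ih _ (hK.trans ⟨L₁ ++ [(x, b), (x, !b)], by simp⟩)

theorem path_mem_of_mem_closure [DecidableEq X] {T : Set (FreeGroup X)} {C : Set S} {s : S}
    (hs : s ∈ C) (hT : ∀ t ∈ T, t • s = s)
    (hC : ∀ t ∈ T, ∀ L', L' <:+ t.toWord → mk L' • s ∈ C) {h : FreeGroup X}
    (hh : h ∈ Subgroup.closure T) : h • s = s ∧ ∀ L', L' <:+ h.toWord → mk L' • s ∈ C := by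
  induction hh using Subgroup.closure_induction with
  | mem t ht => exact ⟨hT t ht, hC t ht⟩
  | one => exact ⟨one_smul _ _, fun L' hL' => by simp_all [← one_eq_mk]⟩
  | mul x y _ _ hx hy =>
    refine ⟨by rw [mul_smul, hy.1, hx.1], ?_⟩
    rw [toWord_mul]
    refine reduce.red.path_subset fun L' hL' => ?_
    rcases suffix_append_cases hL' with ⟨K, rfl, hK⟩ | hK
    · rw [← mul_mk, mk_toWord, mul_smul, hy.1]
      exact hx.2 K hK
    · exact hy.2 L' hK
  | inv x _ hx =>
    refine ⟨by rw [inv_smul_eq_iff, hx.1], fun L' hL' => ?_⟩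
    rw [toWord_inv] at hL'
    obtain ⟨K, hK⟩ := hL'
    have hw : x.toWord = invRev L' ++ invRev K := by
      rw [← invRev_append, hK, invRev_invRev]
    have hmk : mk (invRev L') • mk (invRev K) • s = s := by
      rw [← mul_smul, mul_mk, ← hw, mk_toWord, hx.1]
    rw [← inv_mk, inv_smul_eq_iff] at hmk
    rw [← hmk]
    exact hx.2 _ (hw ▸ List.suffix_append _ _)

theorem drop_suffix_reduce_append [DecidableEq X] (A : List (X × Bool)) {B : List (X × Bool)}
    (hB : IsReduced B) : B.drop A.length <:+ reduce (A ++ B) := by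
  induction A with
  | nil => simp [hB.reduce_eq]
  | cons a A ih =>
    rw [List.cons_append, reduce.cons, List.length_cons, ← List.drop_drop]
    generalize B.drop A.length = D at ih ⊢
    generalize reduce (A ++ B) = R at ih ⊢
    cases R with
    | nil => simp_all
    | cons c R =>
      have htail : D.drop 1 <:+ R := by
        rcases List.suffix_cons_iff.1 ih with rfl | h
        · simp
        · exact (List.drop_suffix 1 D).trans h
      dsimp only
      split_ifs
      · exact htail
      · exact htail.trans ⟨[a, c], rfl⟩

theorem IsReduced.invRev {L : List (X × Bool)} (h : IsReduced L) :
    IsReduced (FreeGroup.invRev L) := by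
  classical
  rw [isReduced_iff_reduce_eq] at h ⊢
  rw [reduce_invRev, h]

theorem IsCyclicallyReduced.invRev {L : List (X × Bool)} (h : IsCyclicallyReduced L) :
    IsCyclicallyReduced (FreeGroup.invRev L) := by
  refine ⟨h.isReduced.invRev, ?_⟩
  simp only [FreeGroup.invRev, List.getLast?_reverse, List.head?_reverse, List.head?_map,
    List.getLast?_map, Option.mem_map]
  rintro _ ⟨a, ha, rfl⟩ _ ⟨b, hb, rfl⟩ hab
  simp [h.2 b hb a ha hab.symm]

/-- A cyclically reduced word or its inverse can be put in front of a reduced word without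
cancellation. -/
theorem IsCyclicallyReduced.isReduced_append_or {L G : List (X × Bool)}
    (hL : IsCyclicallyReduced L) (hG : IsReduced G) :
    IsReduced (L ++ G) ∨ IsReduced (FreeGroup.invRev L ++ G) := by
  have hinv := hL.isReduced.invRev
  simp only [IsReduced, List.isChain_append] at hG hinv ⊢
  by_contra! h
  obtain ⟨a, ha, b, hb, hab, hab'⟩ := h.1 hL.isReduced hG
  obtain ⟨c, hc, d, hd, hcd, hcd'⟩ := h.2 hinv hG
  obtain rfl : b = d := Option.mem_unique hb hd
  simp only [FreeGroup.invRev, List.getLast?_reverse, List.head?_map, Option.mem_map] at hc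
  obtain ⟨e, he, rfl⟩ := hc
  have := hL.2 a ha e he (hab.trans hcd.symm)
  grind

theorem finite_fixedBy {H : Subgroup (FreeGroup X)} (hH : H.FG) {g : FreeGroup X} (hg : g ≠ 1) :
    (MulAction.fixedBy (FreeGroup X ⧸ H) g).Finite := by
  classical
  obtain ⟨T, rfl⟩ := hH
  set H := Subgroup.closure (T : Set (FreeGroup X)) with hH
  let s : FreeGroup X ⧸ H := (1 : FreeGroup X)
  let C : Set (FreeGroup X ⧸ H) :=
    {s} ∪ ⋃ t ∈ T, {v | ∃ L', L' <:+ t.toWord ∧ mk L' • s = v}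
  have hCfin : C.Finite := (Set.finite_singleton s).union <|
    T.finite_toSet.biUnion fun t _ => finite_setOf_path _ _
  have hstab (h : FreeGroup X) : h • s = s ↔ h ∈ H := by
    rw [← MulAction.mem_stabilizer_iff, MulAction.stabilizer_quotient]
  have hpath {h : FreeGroup X} (hh : h ∈ H) (L' : List (X × Bool)) (hL' : L' <:+ h.toWord) :
      mk L' • s ∈ C :=
    (path_mem_of_mem_closure (T := (T : Set (FreeGroup X))) (by simp [C])
      (fun t ht => (hstab t).2 (Subgroup.subset_closure ht))
      (fun t ht L' hL' => .inr (Set.mem_biUnion ht ⟨L', hL', rfl⟩)) hh).2 L' hL'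
  have key (L G : List (X × Bool)) (hL : IsCyclicallyReduced L) (hne : L ≠ [])
      (hLG : IsReduced (L ++ G)) (hfix : mk L • mk G • s = mk G • s) : mk G • s ∈ C := by
    set P := (List.replicate (G.length + 1) L).flatten with hP
    have hPG : IsReduced (P ++ G) := by
      have := IsReduced.append_flatten_replicate_append (L₁ := []) (L₃ := G) hL (by simpa)
        G.length.succ_ne_zero
      simpa using this
    have hlen : G.length ≤ P.length := by
      have : 0 < L.length := List.length_pos_iff.2 hne
      simp only [hP, List.length_flatten, List.map_replicate, List.sum_replicate, smul_eq_mul]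
      nlinarith
    have hmem : mk (invRev G ++ (P ++ G)) ∈ H := by
      rw [← hstab, ← mul_mk, ← mul_mk, ← inv_mk, mul_smul, mul_smul, inv_smul_eq_iff, hP,
        ← pow_mk]
      exact_mod_cast MulAction.mem_fixedBy_zpow hfix (G.length + 1 : ℕ)
    refine hpath hmem G ?_
    rw [toWord_mk]
    refine List.IsSuffix.trans ?_ (drop_suffix_reduce_append (invRev G) hPG)
    rw [invRev_length, List.drop_append_of_le_length hlen]
    exact List.suffix_append _ _
  set c := mk (reduceCyclically.conjugator g.toWord)
  set L := reduceCyclically g.toWord with hL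
  have hLcyc : IsCyclicallyReduced L := reduceCyclically.isCyclicallyReduced isReduced_toWord
  have hgc : g = c * mk L * c⁻¹ := by
    rw [inv_mk, mul_mk, mul_mk, reduceCyclically.conj_conjugator_reduceCyclically, mk_toWord]
  have hLne : L ≠ [] := by
    intro h
    rw [h, ← one_eq_mk] at hgc
    exact hg (by simpa using hgc)
  refine (hCfin.image (c • ·)).subset fun v hv => ⟨c⁻¹ • v, ?_, smul_inv_smul c v⟩
  obtain ⟨u, hu⟩ := QuotientGroup.mk_surjective (c⁻¹ • v)
  have hus : c⁻¹ • v = mk u.toWord • s := by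
    rw [← hu, mk_toWord, MulAction.Quotient.smul_mk, smul_eq_mul, mul_one]
  have hfix : mk L • c⁻¹ • v = c⁻¹ • v := by
    rw [MulAction.mem_fixedBy, hgc, mul_smul, mul_smul, ← eq_inv_smul_iff] at hv
    exact hv
  rw [hus] at hfix ⊢
  rcases hLcyc.isReduced_append_or (isReduced_toWord (x := u)) with h | h
  · exact key L _ hLcyc hLne h hfix
  · refine key _ _ hLcyc.invRev (fun h' => hLne ?_) h ?_
    · rw [← invRev_invRev (L₁ := L), h', invRev_empty]
    · rw [← inv_mk, inv_smul_eq_iff, hfix]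

end FixedPoints

section Separability

universe u v

/-- If nontrivial elements have finitely many fixed points in `S`, then for every `w` there is a
finite action which follows the action on `S` along all paths through a given finite set, and in
which `w` has only fixed points lying over its fixed points in `S`. -/
theorem exists_finite_model {X : Type u} {S : Type v} [MulAction (FreeGroup X) S]
    (hS : ∀ g : FreeGroup X, g ≠ 1 → (MulAction.fixedBy S g).Finite) (w : FreeGroup X)
    {P : Set S} (hP : P.Finite) :
    ∃ (B : Set S) (Q : Type (max u v)) (_ : Group Q) (ρ : FreeGroup X →* Perm (B × Q)),
      Finite (B × Q) ∧ P ⊆ B ∧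
      (∀ (L : List (X × Bool)) (v : B) (q : Q) (hL : ∀ L', L' <:+ L → mk L' • (v : S) ∈ B),
        ρ (mk L) (v, q) = (⟨mk L • (v : S), hL L L.suffix_refl⟩, q)) ∧
      ∀ (v : B) (q : Q), ρ w (v, q) = (v, q) → w • (v : S) = v := by
  classical
  set L := w.toWord with hL
  have hLred : IsReduced L := isReduced_toWord
  let D : Set S := ⋃ γ ∈ {γ | γ <:+: L ∧ γ ≠ []}, MulAction.fixedBy S (mk γ)
  have hD : D.Finite := by
    refine Set.Finite.biUnion ?_ fun γ hγ => hS _ fun h => hγ.2 ?_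
    · exact L.sublists.finite_toSet.subset fun γ hγ => List.mem_sublists.2 hγ.1.sublist
    · rw [← (hLred.infix hγ.1).reduce_eq, ← toWord_mk, h, toWord_one]
  let N : Set S := ⋃ l ∈ {l | l ∈ L}, ((of l.1 • ·) '' D ∪ ((of l.1)⁻¹ • ·) '' D)
  have hN : N.Finite := L.finite_toSet.biUnion fun l _ => (hD.image _).union (hD.image _)
  let B := P ∪ N
  have : Finite B := hP.union hN
  obtain ⟨π, hπ⟩ := exists_extendsPartialAction (X := X) (B := B)
  let z (v : B) : FreeGroup (X × B) := (skewProduct π (freeCocycle B) w (v, 1)).2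
  have hz (v : B) (h1 : (skewProduct π (freeCocycle B) w (v, 1)).1 = v) (h2 : z v = 1) :
      w • (v : S) = v := by
    have := hπ.skewProduct_reduced hLred (fun γ hγ hne t _ hfix l hl => ?_) v
    · rw [hL, mk_toWord] at this
      rcases this with h | ⟨γ, x, b, L', s, ζ, -, -, -, h⟩
      · rw [← h.1, h1]
      · change (z v).toWord = _ at h
        simp [h2] at h
    · have ht : t ∈ D := Set.mem_biUnion (show γ ∈ {γ | γ <:+: L ∧ γ ≠ []} from ⟨hγ, hne⟩) hfix
      exact ⟨.inr (Set.mem_biUnion hl (.inl ⟨t, ht, rfl⟩)),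
        .inr (Set.mem_biUnion hl (.inr ⟨t, ht, rfl⟩))⟩
  have hK (v : B) : ∃ K : FiniteIndexNormalSubgroup (FreeGroup (X × B)), z v ∈ K → z v = 1 := by
    by_cases h : z v = 1
    · exact ⟨.ofSubgroup ⊤, fun _ => h⟩
    · obtain ⟨K, hK⟩ := Group.exists_finiteIndexNormalSubgroup_notMem _ h
      exact ⟨K, fun h => absurd h hK⟩
  choose K hK using hK
  let f : FreeGroup (X × B) →* ∀ v, FreeGroup (X × B) ⧸ (K v).toSubgroup :=
    MonoidHom.pi fun v => QuotientGroup.mk' _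
  refine ⟨B, _, inferInstance, skewProduct π fun x v => f (freeCocycle B x v), inferInstance,
    Set.subset_union_left, fun M v q hM => ?_, fun v q h => ?_⟩
  · exact hπ.skewProduct_path
      (fun x v h => by rw [freeCocycle_eq_one x v h, _root_.map_one]) M v q hM
  · have hmap := skewProduct_map π (freeCocycle B) f w v 1 q
    rw [_root_.map_one, one_mul, h, Prod.mk.injEq] at hmap
    refine hz v hmap.1.symm (hK v ?_)
    have h1 : f (z v) = 1 := by simpa [z] using hmap.2.symm
    exact (QuotientGroup.eq_one_iff _).1 (congrFun h1 v)

end Separability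

end FreeGroup

/-- To separate `H₂` from the conjugates of `H₁` it suffices to find a finite action in which
`H₁` has a fixed point but `H₂` has none. -/
theorem Subgroup.exists_finite_quotient_of_fixedPoint {G Δ : Type*} [Group G] [Finite Δ]
    {H₁ H₂ : Subgroup G} (ρ : G →* Equiv.Perm Δ) (d : Δ) (h₁ : ∀ h ∈ H₁, ρ h d = d)
    (h₂ : ∀ e, ∃ h ∈ H₂, ρ h e ≠ e) :
    ∃ (Q : Type) (_ : Group Q) (_ : Finite Q) (φ : G →* Q),
      Function.Surjective φ ∧ ¬ ∃ q : Q, (H₂.map φ).conjBy q ≤ H₁.map φ := by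
  obtain ⟨n, ⟨e⟩⟩ := Finite.exists_equiv_fin Δ
  let ψ : G →* Equiv.Perm (Fin n) := e.permCongrHom.toMonoidHom.comp ρ
  have hψ (g : G) (x : Δ) : ψ g (e x) = e (ρ g x) := by simp [ψ]
  refine ⟨ψ.range, inferInstance, inferInstance, ψ.rangeRestrict, ψ.rangeRestrict_surjective, ?_⟩
  rintro ⟨q, hq⟩
  obtain ⟨c, rfl⟩ := ψ.rangeRestrict_surjective q
  obtain ⟨h, hh, hne⟩ := h₂ (ρ c d)
  obtain ⟨k, hk, hkeq⟩ := hq ⟨_, ⟨h, hh, rfl⟩, rfl⟩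
  have hkeq' : ψ k = (ψ c)⁻¹ * ψ h * ψ c := by
    simpa [MulAut.conj_apply] using congrArg Subtype.val hkeq
  have : ψ c * ψ k = ψ h * ψ c := by rw [hkeq']; group
  have := DFunLike.congr_fun this (e d)
  simp only [Equiv.Perm.mul_apply, hψ, h₁ k hk, e.injective.eq_iff] at this
  exact hne this.symm

/-- Every free group is subgroup into conjugacy separable (SICS). -/
theorem freeGroup_sics (X : Type*) : SICS (FreeGroup X) := by
  classical
  intro H₁ H₂ hH₁ _ hconj
  have hmove (a : FreeGroup X ⧸ H₁) : ∃ h ∈ H₂, h • a ≠ a := by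
    by_contra! hfix
    obtain ⟨c, rfl⟩ := QuotientGroup.mk_surjective a
    refine hconj ⟨c, ?_⟩
    rintro _ ⟨h, hh, rfl⟩
    have := QuotientGroup.eq.1 (hfix h hh).symm
    simpa [MulAut.conj_apply, mul_assoc] using this
  choose m hm hmne using hmove
  obtain ⟨w, hw, hw1⟩ : ∃ w ∈ H₂, w ≠ 1 := by
    refine ⟨_, hm (1 : FreeGroup X), fun h => hmne (1 : FreeGroup X) ?_⟩
    rw [h, one_smul]
  have hfin (g : FreeGroup X) (hg : g ≠ 1) := FreeGroup.finite_fixedBy hH₁ hg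
  obtain ⟨T, hT⟩ := hH₁
  let path (L : List (X × Bool)) (s : FreeGroup X ⧸ H₁) :=
    {t | ∃ L', L' <:+ L ∧ FreeGroup.mk L' • s = t}
  let s : FreeGroup X ⧸ H₁ := (1 : FreeGroup X)
  let P : Set (FreeGroup X ⧸ H₁) := {s} ∪ (⋃ t ∈ T, path t.toWord s) ∪
    ⋃ a ∈ MulAction.fixedBy (FreeGroup X ⧸ H₁) w, path (m a).toWord a
  have hP : P.Finite := ((Set.finite_singleton s).union <|
    T.finite_toSet.biUnion fun t _ => FreeGroup.finite_setOf_path _ _).union <|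
      (hfin w hw1).biUnion fun a _ => FreeGroup.finite_setOf_path _ _
  obtain ⟨B, Q, _, ρ, hfinite, hPB, hpath, hfix⟩ := FreeGroup.exists_finite_model hfin w hP
  have hs : s ∈ B := hPB (.inl (.inl rfl))
  refine Subgroup.exists_finite_quotient_of_fixedPoint ρ (⟨s, hs⟩, 1) (fun h hh => ?_) ?_
  · suffices H₁ ≤ (MulAction.stabilizer (Equiv.Perm (B × Q)) ((⟨s, hs⟩, 1) : B × Q)).comap ρ from
      this hh
    refine hT.ge.trans ((Subgroup.closure_le _).2 ?_)
    intro t ht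
    have := hpath t.toWord ⟨s, hs⟩ 1 fun L' hL' =>
      hPB (.inl (.inr (Set.mem_biUnion ht ⟨L', hL', rfl⟩)))
    have hts : t • s = s := by
      rw [← MulAction.mem_stabilizer_iff, MulAction.stabilizer_quotient, ← hT]
      exact Subgroup.subset_closure ht
    simp only [FreeGroup.mk_toWord, hts] at this
    exact this
  · rintro ⟨v, q⟩
    by_cases hv : ρ w (v, q) = (v, q)
    · refine ⟨m v, hm v, fun h => hmne v ?_⟩
      have := hpath (m v).toWord v q fun L' hL' =>
        hPB (.inr (Set.mem_biUnion (hfix v q hv) ⟨L', hL', rfl⟩))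
      simp only [FreeGroup.mk_toWord, h, Prod.mk.injEq, and_true] at this
      exact (congrArg Subtype.val this).symm
    · exact ⟨w, hw, hv⟩
end

section
/- Let H₁ and H₂ be subgroups of a group G. Then the following are equivalent: (1) there exists a finite-index subgroup D of G containing H₁ such that H₂ is not conjugate into D; (2) there exists a surjective homomorphism φ from G onto a finite group such that φ(H₂) is not conjugate into φ(H₁). -/
theorem Subgroup.map_conjBy {G Q : Type*} [Group G] [Group Q] (φ : G →* Q)
    (A : Subgroup G) (c : G) : (A.conjBy c).map φ = (A.map φ).conjBy (φ c) := by
  simp only [Subgroup.conjBy, Subgroup.map_map]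
  congr 1
  ext x
  simp

/-- Conjugacy of images under a surjection is conjugacy into the preimage. -/
theorem Subgroup.exists_conjBy_map_le_iff {G Q : Type*} [Group G] [Group Q] {φ : G →* Q}
    (hφ : Function.Surjective φ) (A : Subgroup G) (B : Subgroup Q) :
    (∃ q : Q, (A.map φ).conjBy q ≤ B) ↔ ∃ c : G, A.conjBy c ≤ B.comap φ := by
  simp only [hφ.exists, ← Subgroup.map_conjBy, Subgroup.map_le_iff_le_comap]

/-- For subgroups `H₁`, `H₂` of a group `G`, the following are equivalent:
(1) there is a finite-index subgroup `D` of `G` containing `H₁` such that `H₂`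
is not conjugate into `D`; (2) there is a surjective homomorphism `φ` from `G`
onto a finite group such that `φ(H₂)` is not conjugate into `φ(H₁)`. -/
theorem conSeparated_iff_finite_quotient {G : Type*} [Group G]
    (H₁ H₂ : Subgroup G) :
    (∃ D : Subgroup G, D.FiniteIndex ∧ H₁ ≤ D ∧ ¬ ∃ c : G, H₂.conjBy c ≤ D) ↔
    (∃ (Q : Type) (_ : Group Q) (_ : Finite Q) (φ : G →* Q),
      Function.Surjective φ ∧ ¬ ∃ q : Q, (H₂.map φ).conjBy q ≤ H₁.map φ) := by
  constructor
  · rintro ⟨D, hD, hH, h⟩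
    let e : G ⧸ D.normalCore ≃* Shrink.{0} (G ⧸ D.normalCore) := Shrink.mulEquiv.symm
    let φ := e.toMonoidHom.comp (QuotientGroup.mk' D.normalCore)
    have hφ : Function.Surjective φ := e.surjective.comp (QuotientGroup.mk'_surjective _)
    have hker : φ.ker = D.normalCore :=
      (MonoidHom.ker_mulEquiv_comp _ e).trans (QuotientGroup.ker_mk' _)
    refine ⟨_, inferInstance, inferInstance, φ, hφ, fun hq => h ?_⟩
    obtain ⟨c, hc⟩ := (Subgroup.exists_conjBy_map_le_iff hφ _ _).1 hq
    refine ⟨c, hc.trans ?_⟩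
    rw [Subgroup.comap_map_eq, hker]
    exact sup_le hH D.normalCore_le
  · rintro ⟨Q, _, _, φ, hφ, h⟩
    exact ⟨(H₁.map φ).comap φ, ⟨by
      rw [Subgroup.index_comap_of_surjective _ hφ]
      exact Subgroup.index_ne_zero_of_finite⟩,
      Subgroup.le_comap_map _ _,
      fun hc => h ((Subgroup.exists_conjBy_map_le_iff hφ _ _).2 hc)⟩
end

section
/- Let F be a free group of finite rank and let H₁, H₂ be finitely generated subgroups of F. If g, h ∈ F satisfy H₂^g ≤ H₁ and H₁^h ≤ H₂, then H₂^g = H₁ and H₁^h = H₂; in particular, if each of H₁ and H₂ is conjugate into the other, then H₁ and H₂ are conjugate in F. -/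
open FreeGroup in
/-- A finite set `S` in a set acted on by a free group carries an action of the free group that
agrees with the given one along every word whose trajectory stays inside `S`. -/
theorem FreeGroup.exists_hom_perm_agree {X α : Type*} [MulAction (FreeGroup X) α]
    (S : Set α) (hS : S.Finite) :
    ∃ φ : FreeGroup X →* Equiv.Perm S, ∀ (p : S) (L : List (X × Bool)),
      (∀ L', L' <:+ L → FreeGroup.mk L' • (p : α) ∈ S) →
        (φ (FreeGroup.mk L) p : α) = FreeGroup.mk L • (p : α) := by
  classical
  have := hS.fintype
  have key (x : X) : ∃ σ : Equiv.Perm S, ∀ s : S, of x • (s : α) ∈ S →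
      (σ s : α) = of x • (s : α) := by
    let e : {s : S // of x • (s : α) ∈ S} ≃ {s : S // (of x)⁻¹ • (s : α) ∈ S} :=
      { toFun := fun s => ⟨⟨of x • (s.1 : α), s.2⟩, by simp⟩
        invFun := fun s => ⟨⟨(of x)⁻¹ • (s.1 : α), s.2⟩, by simp⟩
        left_inv := fun s => by ext; simp
        right_inv := fun s => by ext; simp }
    exact ⟨e.extendSubtype, fun s hs => by rw [e.extendSubtype_apply_of_mem s hs]; rfl⟩
  choose σ hσ using key
  refine ⟨FreeGroup.lift σ, fun p L => ?_⟩
  induction L with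
  | nil => intro _; simp [← FreeGroup.one_eq_mk]
  | cons a L ih =>
    intro hL
    have ih' := ih fun L' h => hL L' (h.trans (List.suffix_cons a L))
    have hmem := hL _ List.suffix_rfl
    have hsplit : FreeGroup.mk (a :: L) = FreeGroup.mk [a] * FreeGroup.mk L := by simp
    rw [hsplit, mul_smul] at hmem
    rw [hsplit, MonoidHom.map_mul, mul_smul, ← ih', Equiv.Perm.mul_apply]
    rw [← ih'] at hmem
    generalize FreeGroup.lift σ (FreeGroup.mk L) p = s at hmem
    obtain ⟨x, _ | _⟩ := a
    · have hinv : FreeGroup.mk [(x, false)] = (of x)⁻¹ := rfl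
      rw [hinv] at hmem ⊢
      have hx := hσ x ⟨_, hmem⟩ (by simp)
      rw [MonoidHom.map_inv, FreeGroup.lift_apply_of]
      have hs : σ x ⟨_, hmem⟩ = s := Subtype.ext (by rw [hx]; simp)
      rw [Equiv.Perm.inv_eq_iff_eq.mpr hs.symm]
    · change (FreeGroup.lift σ (of x) s : α) = of x • (s : α)
      rw [FreeGroup.lift_apply_of]
      exact hσ x s hmem

/-- Finitely generated subgroups of free groups are separable: an element outside such a subgroup
is detected by a point stabilizer of an action on a finite set. -/
theorem FreeGroup.exists_finite_perm_separating {X : Type*} {H : Subgroup (FreeGroup X)}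
    (hH : H.FG) {y : FreeGroup X} (hy : y ∉ H) :
    ∃ (S : Set (FreeGroup X ⧸ H)) (_ : Finite S) (φ : FreeGroup X →* Equiv.Perm S) (p : S),
      (∀ x ∈ H, φ x p = p) ∧ φ y p ≠ p := by
  classical
  obtain ⟨T, rfl⟩ := hH
  set H := Subgroup.closure (T : Set (FreeGroup X))
  let o : FreeGroup X ⧸ H := ((1 : FreeGroup X) : FreeGroup X ⧸ H)
  have smul_o (w : FreeGroup X) : w • o = o ↔ w ∈ H := by
    rw [← MulAction.mem_stabilizer_iff, MulAction.stabilizer_quotient]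
  let S : Set (FreeGroup X ⧸ H) :=
    ⋃ w ∈ insert y T, (fun L : List (X × Bool) => FreeGroup.mk L • o) '' {L | L <:+ w.toWord}
  have hS : S.Finite := (Finset.finite_toSet (insert y T)).biUnion fun w _ =>
    Set.Finite.image _ ((w.toWord.tails.finite_toSet).subset fun L hL => by simpa using hL)
  have mem_S {w : FreeGroup X} (hw : w ∈ insert y T) {L : List (X × Bool)} (hL : L <:+ w.toWord) :
      FreeGroup.mk L • o ∈ S :=
    Set.mem_biUnion hw ⟨L, hL, rfl⟩
  have ho : o ∈ S := by
    simpa [← FreeGroup.one_eq_mk] using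
      mem_S (Finset.mem_insert_self y T) (List.nil_suffix (l := y.toWord))
  obtain ⟨φ, hφ⟩ := FreeGroup.exists_hom_perm_agree (X := X) S hS
  have hφ' {w : FreeGroup X} (hw : w ∈ insert y T) : (φ w ⟨o, ho⟩ : FreeGroup X ⧸ H) = w • o := by
    simpa only [FreeGroup.mk_toWord] using hφ ⟨o, ho⟩ w.toWord fun L hL => mem_S hw hL
  refine ⟨S, hS, φ, ⟨o, ho⟩, fun x hx => ?_, fun hfix => hy ?_⟩
  · have hle : H ≤ (MulAction.stabilizer (Equiv.Perm S) (⟨o, ho⟩ : S)).comap φ := by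
      refine (Subgroup.closure_le _).mpr fun w hw => Subtype.ext ?_
      exact (hφ' (Finset.mem_insert_of_mem hw)).trans
        ((smul_o w).mpr (Subgroup.subset_closure hw))
    exact hle hx
  · rw [← smul_o, ← hφ' (Finset.mem_insert_self y T), hfix]

theorem Subgroup.mem_conjBy {G : Type*} [Group G] {A : Subgroup G} {c x : G} :
    x ∈ A.conjBy c ↔ c * x * c⁻¹ ∈ A := by
  rw [Subgroup.conjBy, Subgroup.mem_map_equiv]
  simp

theorem Subgroup.conjBy_conjBy {G : Type*} [Group G] (A : Subgroup G) (c d : G) :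
    (A.conjBy c).conjBy d = A.conjBy (c * d) := by
  ext x
  simp [Subgroup.mem_conjBy, mul_assoc]

theorem Subgroup.conjBy_mono {G : Type*} [Group G] {A B : Subgroup G} (hAB : A ≤ B) (c : G) :
    A.conjBy c ≤ B.conjBy c :=
  Subgroup.map_mono hAB

/-- A finitely generated subgroup of a free group is not conjugate to a proper subgroup of
itself. -/
theorem FreeGroup.conjBy_eq_of_le {X : Type*} {H : Subgroup (FreeGroup X)} (hH : H.FG)
    {c : FreeGroup X} (hc : H.conjBy c ≤ H) : H.conjBy c = H := by
  refine le_antisymm hc fun x hx => ?_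
  rw [Subgroup.mem_conjBy]
  by_contra hy
  obtain ⟨S, _, φ, p, hfix, hne⟩ := FreeGroup.exists_finite_perm_separating hH hy
  have hpow (n : ℕ) : (c ^ n)⁻¹ * x * c ^ n ∈ H := by
    induction n with
    | zero => simpa using hx
    | succ n ih =>
      refine hc (Subgroup.mem_conjBy.mpr ?_)
      convert ih using 1
      group
  obtain ⟨n, hn, hone⟩ := (isOfFinOrder_of_finite (φ c)).exists_pow_eq_one
  obtain ⟨m, rfl⟩ := Nat.exists_eq_succ_of_ne_zero hn.ne'
  have hinv : φ c = (φ c ^ m)⁻¹ := eq_inv_of_mul_eq_one_right (by rwa [← pow_succ])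
  have heq : φ (c * x * c⁻¹) = φ ((c ^ m)⁻¹ * x * c ^ m) := by
    simp only [MonoidHom.map_mul, MonoidHom.map_inv, MonoidHom.map_pow]
    rw [← hinv, ← inv_inv (φ c ^ m), ← hinv]
  exact hne (heq ▸ hfix _ (hpow m))

/-- Let `H₁`, `H₂` be finitely generated subgroups of a free group of finite
rank. If `H₂^g ≤ H₁` and `H₁^h ≤ H₂`, then `H₂^g = H₁` and `H₁^h = H₂`;
in particular `H₁` and `H₂` are conjugate. -/
theorem freeGroup_conj_into_both_ways_eq (X : Type*) [Finite X]
    (H₁ H₂ : Subgroup (FreeGroup X)) (h1 : H₁.FG) (h2 : H₂.FG)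
    (g h : FreeGroup X) (hg : H₂.conjBy g ≤ H₁) (hh : H₁.conjBy h ≤ H₂) :
    H₂.conjBy g = H₁ ∧ H₁.conjBy h = H₂ ∧
      ∃ c : FreeGroup X, H₁.conjBy c = H₂ := by
  have e₁ : H₁.conjBy h = H₂ := by
    refine le_antisymm hh ?_
    have hle := Subgroup.conjBy_mono hg h
    rw [Subgroup.conjBy_conjBy] at hle
    exact (FreeGroup.conjBy_eq_of_le h2 (hle.trans hh)).ge.trans hle
  have e₂ : H₂.conjBy g = H₁ := by
    refine le_antisymm hg ?_
    have hle := Subgroup.conjBy_mono hh g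
    rw [Subgroup.conjBy_conjBy] at hle
    exact (FreeGroup.conjBy_eq_of_le h1 (hle.trans hg)).ge.trans hle
  exact ⟨e₂, e₁, h, e₁⟩
end
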